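/- arXiv:2312.12539 — 3 statements merged into one kernel-verified Lean document; each statement's English description precedes it below -/
import Mathlib

section
/- For every positive integer m, the cardinality of F_{1/m} satisfies |F_{1/m}| = Σ_{j=2}^{m} 2^(ω(j) − 1) + 2, where ω(j) is the number of distinct prime factors of j (the summand 2 accounts for the fractions 0/1 and 1/1). -/
/-- The set `F_{1/m}` of fractions extracted from Ford circles by the line `y = x/m`:
rationals `x` with `0 ≤ x ≤ 1` whose reduced numerator times reduced denominator
is at most `m`. -/
def fordFracs (m : ℕ) : Set ℚ := {x : ℚ | 0 ≤ x ∧ x ≤ 1 ∧ x.num * x.den ≤ m}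

/-- The ordered factorizations of `n` into two coprime factors. -/
def coprimeFactorizations (n : ℕ) : Finset (ℕ × ℕ) :=
  n.divisorsAntidiagonal.filter fun x => x.1.Coprime x.2

theorem mem_coprimeFactorizations {n : ℕ} {x : ℕ × ℕ} :
    x ∈ coprimeFactorizations n ↔ (x.1 * x.2 = n ∧ n ≠ 0) ∧ x.1.Coprime x.2 := by
  simp [coprimeFactorizations]

theorem primeFactors_prod_pow {s : Finset ℕ} {f : ℕ → ℕ} (hs : ∀ p ∈ s, p.Prime)
    (hf : ∀ p ∈ s, f p ≠ 0) : (∏ p ∈ s, p ^ f p).primeFactors = s := by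
  ext q
  rw [Nat.mem_primeFactors]
  constructor
  · rintro ⟨hq, hdvd, -⟩
    obtain ⟨p, hp, hqp⟩ := (hq.prime.dvd_finsetProd_iff _).1 hdvd
    rwa [(Nat.prime_dvd_prime_iff_eq hq (hs p hp)).1 (hq.dvd_of_dvd_pow hqp)]
  · intro hq
    exact ⟨hs q hq, (dvd_pow_self q (hf q hq)).trans (Finset.dvd_prod_of_mem _ hq),
      Finset.prod_ne_zero_iff.2 fun p hp => pow_ne_zero _ (hs p hp).ne_zero⟩

/-- In a coprime factorization, a factor is the product of the primary parts of `a * b` at the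
primes dividing it. -/
theorem Nat.Coprime.prod_primeFactors_pow_factorization_mul {a b : ℕ} (h : a.Coprime b)
    (ha : a ≠ 0) : ∏ p ∈ a.primeFactors, p ^ (a * b).factorization p = a := by
  conv_rhs => rw [← Nat.prod_factorization_pow_eq_self ha]
  refine Finset.prod_congr rfl fun p hp => ?_
  rw [Nat.factorization_eq_of_coprime_left h (by simpa using hp)]

theorem card_coprimeFactorizations {n : ℕ} (hn : n ≠ 0) :
    (coprimeFactorizations n).card = 2 ^ n.primeFactors.card := by
  have hprime : ∀ p ∈ n.primeFactors, p.Prime := fun p => Nat.prime_of_mem_primeFactors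
  have hfact : ∀ p ∈ n.primeFactors, n.factorization p ≠ 0 := fun p hp =>
    Finsupp.mem_support_iff.1 (by simpa using hp)
  rw [← Finset.card_powerset]
  symm
  refine Finset.card_nbij'
    (fun s => (∏ p ∈ s, p ^ n.factorization p, ∏ p ∈ n.primeFactors \ s, p ^ n.factorization p))
    (fun x => x.1.primeFactors) ?_ ?_ ?_ ?_
  · intro s hs
    rw [Finset.mem_coe, Finset.mem_powerset] at hs
    rw [Finset.mem_coe, mem_coprimeFactorizations]
    refine ⟨⟨?_, hn⟩, ?_⟩
    · rw [mul_comm, Finset.prod_sdiff hs]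
      exact Nat.prod_factorization_pow_eq_self hn
    · refine Nat.Coprime.prod_left fun p hp => Nat.Coprime.prod_right fun q hq => ?_
      rw [Finset.mem_sdiff] at hq
      refine Nat.Coprime.pow _ _ ((Nat.coprime_primes (hprime p (hs hp)) (hprime q hq.1)).2 ?_)
      rintro rfl
      exact hq.2 hp
  · rintro ⟨a, b⟩ hx
    obtain ⟨⟨rfl, h0⟩, -⟩ := mem_coprimeFactorizations.1 hx
    rw [Finset.mem_coe, Finset.mem_powerset]
    exact Nat.primeFactors_mono (dvd_mul_right a b) h0
  · intro s hs
    rw [Finset.mem_coe, Finset.mem_powerset] at hs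
    exact primeFactors_prod_pow (fun p hp => hprime p (hs hp)) fun p hp => hfact p (hs hp)
  · rintro ⟨a, b⟩ hx
    obtain ⟨⟨rfl, h0⟩, hab⟩ := mem_coprimeFactorizations.1 hx
    dsimp only at h0 hab ⊢
    have hsd : (a * b).primeFactors \ a.primeFactors = b.primeFactors := by
      rw [hab.primeFactors_mul, Finset.union_sdiff_cancel_left hab.disjoint_primeFactors]
    rw [hsd, hab.prod_primeFactors_pow_factorization_mul (left_ne_zero_of_mul h0), mul_comm a b,
      hab.symm.prod_primeFactors_pow_factorization_mul (right_ne_zero_of_mul h0)]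

theorem card_coprimeFactorizations_filter_le {n : ℕ} (hn : 2 ≤ n) :
    ((coprimeFactorizations n).filter fun x => x.1 ≤ x.2).card
      = 2 ^ (n.primeFactors.card - 1) := by
  have hswap : ((coprimeFactorizations n).filter fun x => ¬ x.1 ≤ x.2).card
      = ((coprimeFactorizations n).filter fun x => x.1 ≤ x.2).card := by
    refine Finset.card_nbij' Prod.swap Prod.swap ?_ ?_ (fun _ _ => rfl) (fun _ _ => rfl)
    · rintro ⟨a, b⟩ hx
      simp only [Finset.coe_filter, Set.mem_ofPred_eq, mem_coprimeFactorizations, Prod.swap] at hx ⊢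
      obtain ⟨⟨⟨hmul, h0⟩, hab⟩, hle⟩ := hx
      exact ⟨⟨⟨by rwa [mul_comm], h0⟩, hab.symm⟩, by omega⟩
    · rintro ⟨a, b⟩ hx
      simp only [Finset.coe_filter, Set.mem_ofPred_eq, mem_coprimeFactorizations, Prod.swap] at hx ⊢
      obtain ⟨⟨⟨hmul, h0⟩, hab⟩, hle⟩ := hx
      refine ⟨⟨⟨by rwa [mul_comm], h0⟩, hab.symm⟩, fun hba => ?_⟩
      obtain rfl := le_antisymm hle hba
      rw [Nat.coprime_self] at hab
      subst hab
      omega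
  have htotal := Finset.card_filter_add_card_filter_not (s := coprimeFactorizations n)
    (fun x => x.1 ≤ x.2)
  rw [hswap, card_coprimeFactorizations (by omega)] at htotal
  have hpos : 0 < n.primeFactors.card :=
    Finset.card_pos.2 (Nat.nonempty_primeFactors.2 (by omega))
  obtain ⟨k, hk⟩ := Nat.exists_eq_add_of_lt hpos
  rw [hk] at htotal ⊢
  simp only [zero_add, pow_succ, Nat.add_sub_cancel] at htotal ⊢
  omega

/-- The pairs of numerator and denominator of the nonzero elements of `fordFracs m`. -/
def fordPairs (m : ℕ) : Finset (ℕ × ℕ) :=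
  (Finset.Icc 1 m).biUnion fun j => (coprimeFactorizations j).filter fun x => x.1 ≤ x.2

theorem mem_fordPairs {m : ℕ} {x : ℕ × ℕ} :
    x ∈ fordPairs m ↔ 0 < x.1 ∧ x.1.Coprime x.2 ∧ x.1 ≤ x.2 ∧ x.1 * x.2 ≤ m := by
  simp only [fordPairs, Finset.mem_biUnion, Finset.mem_Icc, Finset.mem_filter,
    mem_coprimeFactorizations]
  constructor
  · rintro ⟨j, ⟨-, hjm⟩, ⟨⟨rfl, h0⟩, hx⟩, hle⟩
    exact ⟨Nat.pos_of_ne_zero (left_ne_zero_of_mul h0), hx, hle, hjm⟩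
  · rintro ⟨hpos, hx, hle, hm⟩
    have h0 : 0 < x.1 * x.2 := Nat.mul_pos hpos (hpos.trans_le hle)
    exact ⟨_, ⟨h0, hm⟩, ⟨⟨rfl, h0.ne'⟩, hx⟩, hle⟩

theorem card_fordPairs {m : ℕ} (hm : 0 < m) :
    (fordPairs m).card = (∑ j ∈ Finset.Icc 2 m, 2 ^ (j.primeFactors.card - 1)) + 1 := by
  rw [fordPairs, Finset.card_biUnion]
  · rw [← Finset.add_sum_Ioc_eq_sum_Icc hm, add_comm]
    congr 1
    exact Finset.sum_congr rfl fun j hj =>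
      card_coprimeFactorizations_filter_le (Finset.mem_Icc.1 hj).1
  · intro i _ j _ hij
    refine Finset.disjoint_left.2 fun x hi hj => ?_
    rw [Finset.mem_filter, mem_coprimeFactorizations] at hi hj
    exact hij (hi.1.1.1.symm.trans hj.1.1.1)

theorem injOn_fordPairs_div (m : ℕ) :
    Set.InjOn (fun x : ℕ × ℕ => (x.1 / x.2 : ℚ)) (fordPairs m) := by
  rintro ⟨a, b⟩ hx ⟨c, d⟩ hy h
  obtain ⟨ha, hab, hle, -⟩ := mem_fordPairs.1 hx
  obtain ⟨hc, hcd, hle', -⟩ := mem_fordPairs.1 hy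
  dsimp only at *
  have := Rat.div_int_inj (a := a) (b := b) (c := c) (d := d) (by omega) (by omega)
    (by simpa using hab) (by simpa using hcd) (by simpa using h)
  simpa using this

theorem fordFracs_eq_insert (m : ℕ) :
    fordFracs m = insert 0 ((fun x : ℕ × ℕ => (x.1 / x.2 : ℚ)) '' (fordPairs m)) := by
  ext q
  simp only [fordFracs, Set.mem_ofPred_eq, Set.mem_insert_iff, Set.mem_image, Finset.mem_coe,
    mem_fordPairs, Prod.exists]
  constructor
  · rintro ⟨h0, h1, hm⟩
    rcases h0.eq_or_lt with rfl | hpos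
    · exact Or.inl rfl
    have hnum : 0 < q.num := Rat.num_pos.2 hpos
    have hcast : (q.num.natAbs : ℤ) = q.num := Int.natAbs_of_nonneg hnum.le
    refine Or.inr ⟨q.num.natAbs, q.den, ⟨by omega, q.reduced, ?_, ?_⟩, ?_⟩
    · have := Rat.num_le_denom_iff.2 h1
      omega
    · rw [← hcast] at hm
      exact_mod_cast hm
    · rw [← Int.cast_natCast q.num.natAbs, hcast, Rat.num_div_den]
  · rintro (rfl | ⟨a, b, ⟨ha, hab, hle, hm⟩, rfl⟩)
    · simp
    have hb : 0 < b := ha.trans_le hle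
    refine ⟨by positivity, div_le_one_of_le₀ (by exact_mod_cast hle) (by positivity), ?_⟩
    have hn := Rat.num_div_eq_of_coprime (a := a) (b := b) (by omega) (by simpa using hab)
    have hd := Rat.den_div_eq_of_coprime (a := a) (b := b) (by omega) (by simpa using hab)
    simp only [Int.cast_natCast] at hn hd
    rw [hn, hd]
    exact_mod_cast hm

/-- For every positive integer `m`,
`|F_{1/m}| = (∑_{j=2}^{m} 2 ^ (ω(j) - 1)) + 2`, where `ω(j)` is the number of distinct
prime factors of `j` (the `+2` accounts for the fractions `0/1` and `1/1`). -/
theorem card_fordFracs_eq_sum_two_pow (m : ℕ) (hm : 0 < m) :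
    (fordFracs m).ncard = (∑ j ∈ Finset.Icc 2 m, 2 ^ (j.primeFactors.card - 1)) + 2 := by
  rw [fordFracs_eq_insert, Set.ncard_insert_of_notMem,
    (injOn_fordPairs_div m).ncard_image, Set.ncard_coe_finset, card_fordPairs hm]
  · rintro ⟨⟨a, b⟩, hx, h⟩
    obtain ⟨ha, -, hle, -⟩ := mem_fordPairs.1 hx
    have hb : 0 < b := ha.trans_le hle
    have : (0 : ℚ) < a / b := by positivity
    exact this.ne' h
end

section
/- For every positive integer m, the cardinality of F_{1/m} satisfies |F_{1/m}| = (1/2)·Σ_{j=2}^{m} Σ_{d ∣ j} μ(d)² + 2, where μ is the Möbius function; equivalently, 2·(|F_{1/m}| − 2) = Σ_{j=2}^{m} Σ_{d ∣ j} μ(d)². -/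
open ArithmeticFunction

open Finset in
/-- Every integer `j ≠ 0` has as many squarefree divisors as factorizations `j = a * b` into
coprime factors: the factorization `(a, b)` corresponds to the radical of `a`. -/
theorem card_coprime_divisorsAntidiagonal {j : ℕ} (hj : j ≠ 0) :
    #{x ∈ j.divisorsAntidiagonal | x.1.Coprime x.2} = #{d ∈ j.divisors | Squarefree d} := by
  refine card_nbij (fun x => ∏ p ∈ x.1.primeFactors, p) ?_ ?_ ?_
  · rintro ⟨a, b⟩ h
    simp only [coe_filter, Set.mem_ofPred_eq, Nat.mem_divisorsAntidiagonal] at h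
    obtain ⟨⟨rfl, h0⟩, -⟩ := h
    simp only [coe_filter, Set.mem_ofPred_eq, Nat.mem_divisors]
    refine ⟨⟨(Nat.prod_primeFactors_dvd a).trans (dvd_mul_right a b), h0⟩, ?_⟩
    exact Finset.squarefree_prod_of_pairwise_isCoprime
      (fun p hp q hq hpq => Nat.coprime_iff_isRelPrime.1 <|
        (Nat.coprime_primes (Nat.prime_of_mem_primeFactors hp)
          (Nat.prime_of_mem_primeFactors hq)).2 hpq)
      fun p hp => (Nat.prime_of_mem_primeFactors hp).prime.squarefree
  · rintro ⟨a, b⟩ h ⟨c, d⟩ h' hrad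
    simp only [coe_filter, Set.mem_ofPred_eq, Nat.mem_divisorsAntidiagonal] at h h' hrad
    have hsupp : a.primeFactors = c.primeFactors := by
      rw [← Nat.primeFactors_prod_primeFactors a, hrad, Nat.primeFactors_prod_primeFactors]
    have ha : a ≠ 0 := left_ne_zero_of_mul (h.1.1 ▸ hj)
    have hc : c ≠ 0 := left_ne_zero_of_mul (h'.1.1 ▸ hj)
    have hac : a = c := by
      refine Nat.eq_of_factorization_eq ha hc fun p => ?_
      by_cases hp : p ∈ a.primeFactors
      · have hpc : p ∈ c.primeFactors := hsupp ▸ hp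
        rw [← Nat.factorization_eq_of_coprime_left h.2 (List.mem_toFinset.1 hp),
          ← Nat.factorization_eq_of_coprime_left h'.2 (List.mem_toFinset.1 hpc),
          h.1.1, h'.1.1]
      · rw [← Nat.support_factorization] at hp
        rw [Finsupp.notMem_support_iff.1 hp]
        rw [Nat.support_factorization, hsupp, ← Nat.support_factorization] at hp
        rw [Finsupp.notMem_support_iff.1 hp]
    subst hac
    rw [Nat.eq_of_mul_eq_mul_left ha.bot_lt (h.1.1.trans h'.1.1.symm)]
  · intro d hd
    simp only [coe_filter, Set.mem_ofPred_eq, Nat.mem_divisors] at hd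
    obtain ⟨⟨hdj, -⟩, hsq⟩ := hd
    have hsub : d.primeFactors ⊆ j.primeFactors := Nat.primeFactors_mono hdj hj
    refine ⟨(∏ p ∈ d.primeFactors, p ^ j.factorization p,
      ∏ p ∈ j.primeFactors \ d.primeFactors, p ^ j.factorization p), ?_, ?_⟩
    · simp only [coe_filter, Set.mem_ofPred_eq, Nat.mem_divisorsAntidiagonal]
      refine ⟨⟨?_, hj⟩, ?_⟩
      · rw [mul_comm, prod_sdiff hsub]
        exact Nat.prod_factorization_pow_eq_self hj
      · refine Nat.Coprime.prod_left fun p hp => Nat.Coprime.prod_right fun q hq => ?_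
        rw [mem_sdiff] at hq
        refine Nat.Coprime.pow _ _ ((Nat.coprime_primes (Nat.prime_of_mem_primeFactors hp)
          (Nat.prime_of_mem_primeFactors hq.1)).2 ?_)
        rintro rfl
        exact hq.2 hp
    · suffices h :
          (∏ p ∈ d.primeFactors, p ^ j.factorization p).primeFactors = d.primeFactors by
        simp only [h, Nat.prod_primeFactors_of_squarefree hsq]
      have hprime : ∀ p ∈ d.primeFactors, p.Prime := fun p => Nat.prime_of_mem_primeFactors
      have hne : ∏ p ∈ d.primeFactors, p ^ j.factorization p ≠ 0 :=
        prod_ne_zero_iff.2 fun p hp => pow_ne_zero _ (hprime p hp).ne_zero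
      ext q
      rw [Nat.mem_primeFactors_of_ne_zero hne]
      constructor
      · rintro ⟨hq, hdvd⟩
        obtain ⟨p, hp, hqp⟩ := (hq.prime.dvd_finsetProd_iff _).1 hdvd
        rwa [(Nat.prime_dvd_prime_iff_eq hq (hprime p hp)).1 (hq.dvd_of_dvd_pow hqp)]
      · intro hq
        refine ⟨hprime q hq, (dvd_pow_self q ?_).trans (dvd_prod_of_mem _ hq)⟩
        exact Finsupp.mem_support_iff.1 ((Nat.support_factorization j).symm ▸ hsub hq)

open Finset in
theorem sum_divisors_moebius_sq (j : ℕ) :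
    ∑ d ∈ j.divisors, (moebius d) ^ 2 = #{d ∈ j.divisors | Squarefree d} := by
  simp [moebius_sq]

open Finset in
theorem two_mul_card_coprime_lt_divisorsAntidiagonal {j : ℕ} (hj : 2 ≤ j) :
    2 * #{x ∈ j.divisorsAntidiagonal | x.1.Coprime x.2 ∧ x.1 < x.2} =
      #{x ∈ j.divisorsAntidiagonal | x.1.Coprime x.2} := by
  have hswap : #{x ∈ j.divisorsAntidiagonal | x.1.Coprime x.2 ∧ x.1 < x.2} =
      #{x ∈ j.divisorsAntidiagonal | x.1.Coprime x.2 ∧ ¬ x.1 < x.2} := by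
    refine card_nbij' Prod.swap Prod.swap ?_ ?_ (fun _ _ => rfl) (fun _ _ => rfl)
    · rintro ⟨a, b⟩ h
      simp only [coe_filter, Set.mem_ofPred_eq, Nat.mem_divisorsAntidiagonal, Prod.swap] at h ⊢
      exact ⟨⟨by rw [mul_comm, h.1.1], h.1.2⟩, h.2.1.symm, h.2.2.not_gt⟩
    · rintro ⟨a, b⟩ h
      simp only [coe_filter, Set.mem_ofPred_eq, Nat.mem_divisorsAntidiagonal, Prod.swap] at h ⊢
      refine ⟨⟨by rw [mul_comm, h.1.1], h.1.2⟩, h.2.1.symm, (not_lt.1 h.2.2).lt_of_ne ?_⟩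
      rintro rfl
      have hb : b = 1 := (Nat.coprime_self b).1 h.2.1
      subst hb
      lia
  rw [two_mul]
  nth_rw 2 [hswap]
  simp only [← filter_filter]
  exact card_filter_add_card_filter_not _

open Finset in
theorem setOf_num_mul_den_eq {j : ℕ} (hj : 2 ≤ j) :
    {x : ℚ | 0 ≤ x ∧ x ≤ 1 ∧ x.num * x.den = j} =
      (fun p : ℕ × ℕ => (p.1 : ℚ) / p.2) ''
        ({x ∈ j.divisorsAntidiagonal | x.1.Coprime x.2 ∧ x.1 < x.2} : Finset (ℕ × ℕ)) := by
  ext x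
  simp only [Set.mem_ofPred_eq, Set.mem_image, coe_filter, Nat.mem_divisorsAntidiagonal,
    Prod.exists]
  constructor
  · rintro ⟨h0, h1, h⟩
    obtain ⟨a, ha⟩ := Int.eq_ofNat_of_zero_le (Rat.num_nonneg.2 h0)
    have hle : x.num ≤ x.den := Rat.num_le_denom_iff.2 h1
    have hcop : a.Coprime x.den := by simpa [ha] using x.reduced
    rw [ha] at h hle
    norm_cast at h hle
    refine ⟨a, x.den, ⟨⟨h, by lia⟩, hcop, hle.lt_of_ne fun hax => ?_⟩, ?_⟩
    · rw [hax, Nat.coprime_self] at hcop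
      rw [hax, hcop] at h
      lia
    · conv_rhs => rw [← Rat.num_div_den x, ha]
      rfl
  · rintro ⟨a, b, ⟨⟨h, -⟩, hcop, hlt⟩, rfl⟩
    have hb : 0 < b := a.zero_le.trans_lt hlt
    refine ⟨by positivity, ?_, ?_⟩
    · rw [div_le_one (by exact_mod_cast hb)]
      exact_mod_cast hlt.le
    · have hn := Rat.num_div_eq_of_coprime (a := a) (b := b) (by exact_mod_cast hb) hcop
      have hd := Rat.den_div_eq_of_coprime (a := a) (b := b) (by exact_mod_cast hb) hcop
      push_cast at hn hd
      rw [hn, hd]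
      exact_mod_cast h

open Finset in
theorem ncard_setOf_num_mul_den_eq {j : ℕ} (hj : 2 ≤ j) :
    {x : ℚ | 0 ≤ x ∧ x ≤ 1 ∧ x.num * x.den = j}.ncard =
      #{x ∈ j.divisorsAntidiagonal | x.1.Coprime x.2 ∧ x.1 < x.2} := by
  rw [setOf_num_mul_den_eq hj, Set.InjOn.ncard_image, Set.ncard_coe_finset]
  rintro ⟨a, b⟩ h ⟨c, d⟩ h' heq
  simp only [coe_filter, Set.mem_ofPred_eq] at h h' heq
  have hb : (0 : ℤ) < b := by lia
  have hd : (0 : ℤ) < d := by lia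
  have := Rat.div_int_inj (a := a) (c := c) hb hd h.2.1 h'.2.1 (by simpa using heq)
  simpa using this

theorem fordFracs_succ (m : ℕ) :
    fordFracs (m + 1) =
      fordFracs m ∪ {x : ℚ | 0 ≤ x ∧ x ≤ 1 ∧ x.num * x.den = (m + 1 : ℕ)} := by
  ext x
  simp only [fordFracs, Set.mem_ofPred_eq, Set.mem_union]
  push_cast
  rw [Int.le_add_one_iff]
  tauto

theorem disjoint_fordFracs (m : ℕ) :
    Disjoint (fordFracs m) {x : ℚ | 0 ≤ x ∧ x ≤ 1 ∧ x.num * x.den = (m + 1 : ℕ)} := by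
  rw [Set.disjoint_left]
  rintro x ⟨-, -, h⟩ ⟨-, -, h'⟩
  lia

theorem fordFracs_one : fordFracs 1 = {0, 1} := by
  ext x
  simp only [fordFracs, Set.mem_ofPred_eq, Set.mem_insert_iff, Set.mem_singleton_iff]
  constructor
  · rintro ⟨h0, h1, h⟩
    have hle : x.num ≤ x.den := Rat.num_le_denom_iff.2 h1
    have hn : 0 ≤ x.num := Rat.num_nonneg.2 h0
    have hd : (0 : ℤ) < x.den := by exact_mod_cast x.den_pos
    obtain hx | hx := hn.eq_or_lt
    · exact .inl (Rat.num_eq_zero.1 hx.symm)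
    · have hden : (x.den : ℤ) = 1 := by push_cast at h; nlinarith
      have hnum : x.num = 1 := by lia
      right
      rw [← Rat.num_div_den x, hnum, Nat.cast_eq_one.1 hden]
      simp
  · rintro (rfl | rfl) <;> simp

theorem finite_setOf_num_mul_den_eq {j : ℕ} (hj : 2 ≤ j) :
    {x : ℚ | 0 ≤ x ∧ x ≤ 1 ∧ x.num * x.den = j}.Finite := by
  rw [setOf_num_mul_den_eq hj]
  exact (Finset.finite_toSet _).image _

theorem finite_fordFracs {m : ℕ} (hm : 1 ≤ m) : (fordFracs m).Finite := by
  induction m, hm using Nat.le_induction with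
  | base => simp [fordFracs_one]
  | succ m hm ih =>
    rw [fordFracs_succ]
    exact ih.union (finite_setOf_num_mul_den_eq (by lia))

/-- For every positive integer `m`,
`|F_{1/m}| = (1/2) ∑_{j=2}^{m} ∑_{d ∣ j} μ(d)² + 2`, where `μ` is the Möbius function;
equivalently `2 (|F_{1/m}| - 2) = ∑_{j=2}^{m} ∑_{d ∣ j} μ(d)²`. -/
theorem two_mul_card_fordFracs_sub_two_eq_sum_moebius_sq (m : ℕ) (hm : 0 < m) :
    2 * (((fordFracs m).ncard : ℤ) - 2) =
      ∑ j ∈ Finset.Icc 2 m, ∑ d ∈ j.divisors, (moebius d) ^ 2 := by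
  induction m, hm using Nat.le_induction with
  | base => simp [fordFracs_one]
  | succ m hm ih =>
    have hm2 : 2 ≤ m + 1 := Nat.succ_le_succ hm
    rw [Finset.sum_Icc_succ_top hm2, ← ih, fordFracs_succ,
      Set.ncard_union_eq (disjoint_fordFracs m) (finite_fordFracs hm)
        (finite_setOf_num_mul_den_eq hm2),
      ncard_setOf_num_mul_den_eq hm2, sum_divisors_moebius_sq,
      ← card_coprime_divisorsAntidiagonal m.succ_ne_zero,
      ← two_mul_card_coprime_lt_divisorsAntidiagonal hm2]
    push_cast
    ring
end

section
/- There is a constant K > 0 such that for every integer m ≥ 2, | Σ_{q = ⌊√m⌋ + 1}^{m} φ(q)/q² − (3/π²)·ln m | ≤ K·(ln m)/√m, where φ is Euler's totient function; that is, Σ_{√m < q ≤ m} φ(q)/q² = (1/(2ζ(2)))·ln m + O((ln m)/√m). -/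
open scoped ArithmeticFunction.Moebius

/-- The Möbius inversion `φ(q)/q² = ∑_{d e = q} (μ(d)/d²) (1/e)`, summed over `q ≤ n`. -/
theorem sum_totient_div_sq_eq_sum_moebius_mul_harmonic (n : ℕ) :
    ∑ q ∈ Finset.Ioc 0 n, (Nat.totient q : ℝ) / q ^ 2 =
      ∑ d ∈ Finset.Ioc 0 n, (μ d : ℝ) / d ^ 2 * (harmonic (n / d) : ℝ) := by
  let f : ArithmeticFunction ℝ := ⟨fun d => (μ d : ℝ) / d ^ 2, by simp⟩
  let g : ArithmeticFunction ℝ := ⟨fun e => (e : ℝ)⁻¹, by simp⟩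
  have key := ArithmeticFunction.sum_Ioc_mul_eq_sum_sum f g n
  have hφ := (ArithmeticFunction.sum_eq_iff_sum_mul_moebius_eq
    (f := fun k => (Nat.totient k : ℝ)) (g := fun k => (k : ℝ))).1
    (fun k _ => by exact_mod_cast Nat.sum_totient k)
  calc _ = ∑ q ∈ Finset.Ioc 0 n, (f * g) q := by
        refine Finset.sum_congr rfl fun q hq => ?_
        rw [Finset.mem_Ioc] at hq
        rw [← hφ q hq.1, ArithmeticFunction.mul_apply, Finset.sum_div]
        refine Finset.sum_congr rfl fun x hx => ?_
        obtain ⟨hx, -⟩ := Nat.mem_divisorsAntidiagonal.1 hx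
        have h1 : (x.1 : ℝ) ≠ 0 := by
          rintro h
          rw [Nat.cast_eq_zero] at h
          simp [h] at hx
          omega
        have h2 : (x.2 : ℝ) ≠ 0 := by
          rintro h
          rw [Nat.cast_eq_zero] at h
          simp [h] at hx
          omega
        simp only [f, g, ArithmeticFunction.coe_mk, ← hx]
        push_cast
        field_simp
    _ = _ := by
        rw [key]
        refine Finset.sum_congr rfl fun d _ => ?_
        simp only [f, g, ArithmeticFunction.coe_mk, harmonic_eq_sum_Icc]
        push_cast
        rfl

theorem abs_harmonic_div_sub_log_sub_eulerMascheroni_le {n d : ℕ} (hd : 0 < d) (hdn : d ≤ n) :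
    |(harmonic (n / d) : ℝ) - Real.log ((n : ℝ) / d) - Real.eulerMascheroniConstant| ≤
      2 * d / n := by
  have hk : 0 < n / d := Nat.div_pos hdn hd
  have h1 := Real.eulerMascheroniSeq_lt_eulerMascheroniConstant (n / d)
  have h2 := Real.eulerMascheroniConstant_lt_eulerMascheroniSeq' (n / d)
  rw [Real.eulerMascheroniSeq'] at h2
  rw [Real.eulerMascheroniSeq] at h1
  rw [if_neg hk.ne'] at h2
  have hdR : (0 : ℝ) < d := by exact_mod_cast hd
  have hnR : (0 : ℝ) < n := by exact_mod_cast hd.trans_le hdn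
  have hle : ((n / d : ℕ) : ℝ) ≤ (n : ℝ) / d := Nat.cast_div_le
  have hlt : (n : ℝ) / d < ((n / d : ℕ) : ℝ) + 1 := by
    rw [div_lt_iff₀ hdR]
    have := Nat.lt_mul_div_succ n hd
    rw [mul_comm] at this
    exact_mod_cast this
  generalize n / d = k at *
  have hkR : (1 : ℝ) ≤ k := by exact_mod_cast hk
  have l1 := Real.log_le_log (by linarith) hle
  have l2 := Real.log_le_log (by positivity) hlt.le
  have l3 : Real.log (k + 1) - Real.log k ≤ 1 / k := by
    rw [← Real.log_div (by positivity) (by positivity)]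
    refine (Real.log_le_sub_one_of_pos (by positivity)).trans (le_of_eq ?_)
    field_simp
    ring
  have l4 : 1 / (k : ℝ) ≤ 2 * d / n := by
    rw [div_lt_iff₀ hdR] at hlt
    rw [div_le_div_iff₀ (by linarith) hnR]
    nlinarith
  rw [abs_le]
  constructor <;> linarith

theorem abs_moebius_div_sq_le (d : ℕ) : |(μ d : ℝ) / d ^ 2| ≤ ((d : ℝ) ^ 2)⁻¹ := by
  have h : |(μ d : ℝ)| ≤ 1 := by exact_mod_cast ArithmeticFunction.abs_moebius_le_one (n := d)
  rw [abs_div, abs_of_nonneg (by positivity : (0 : ℝ) ≤ d ^ 2), ← one_div]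
  gcongr

theorem hasSum_moebius_div_sq :
    HasSum (fun d : ℕ => (μ d : ℝ) / d ^ 2) (6 / Real.pi ^ 2) := by
  have hs : 1 < (2 : ℂ).re := by norm_num
  have h := (ArithmeticFunction.LSeriesSummable_moebius_iff.2 hs).LSeriesHasSum
  have h1 := LSeries_one_mul_Lseries_moebius hs
  rw [LSeries_one_eq_riemannZeta hs, riemannZeta_two] at h1
  have hpi : (Real.pi : ℂ) ≠ 0 := by exact_mod_cast Real.pi_ne_zero
  have h2 : LSeries (fun n => (μ n : ℂ)) 2 = ((6 / Real.pi ^ 2 : ℝ) : ℂ) := by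
    push_cast
    field_simp
    linear_combination 6 * h1
  rw [h2, LSeriesHasSum] at h
  rw [← Complex.hasSum_ofReal]
  convert h using 2 with d
  rcases eq_or_ne d 0 with rfl | hd
  · simp
  · rw [LSeries.term_of_ne_zero hd]
    norm_cast

theorem abs_sum_moebius_div_sq_sub_le {s : ℕ} (hs : 0 < s) :
    |∑ d ∈ Finset.Ioc 0 s, (μ d : ℝ) / d ^ 2 - 6 / Real.pi ^ 2| ≤ 1 / (s : ℝ) := by
  have ht := hasSum_moebius_div_sq.tendsto_sum_nat.comp (Filter.tendsto_add_atTop_nat 1)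
  have ht' := (ht.const_sub (∑ d ∈ Finset.Ioc 0 s, (μ d : ℝ) / d ^ 2)).abs
  refine le_of_tendsto ht' ?_
  filter_upwards [Filter.eventually_ge_atTop s] with N hN
  have e : ∑ d ∈ Finset.range (N + 1), (μ d : ℝ) / d ^ 2 =
      ∑ d ∈ Finset.Ioc 0 s, (μ d : ℝ) / d ^ 2 + ∑ d ∈ Finset.Ioc s N, (μ d : ℝ) / d ^ 2 := by
    rw [Finset.sum_Ioc_consecutive _ (Nat.zero_le s) hN, Finset.range_eq_Ico,
      Finset.sum_eq_sum_Ico_succ_bot (Nat.succ_pos N)]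
    simp
    rfl
  simp only [Function.comp_apply]
  rw [e, sub_add_cancel_left, abs_neg]
  refine (Finset.abs_sum_le_sum_abs _ _).trans
    ((Finset.sum_le_sum fun d _ => abs_moebius_div_sq_le d).trans
    ((sum_Ioc_inv_sq_le_sub hs.ne' hN).trans ?_))
  rw [one_div]
  have : (0 : ℝ) ≤ (N : ℝ)⁻¹ := by positivity
  linarith

theorem abs_sum_Ioc_totient_div_sq_sub_le {s m : ℕ} (hs : 0 < s) (hsm : s ≤ m) :
    |∑ q ∈ Finset.Ioc s m, (Nat.totient q : ℝ) / q ^ 2 -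
        6 / Real.pi ^ 2 * Real.log ((m : ℝ) / s)| ≤ (5 + 6 * Real.log m) / s := by
  have hsR : (1 : ℝ) ≤ s := by exact_mod_cast hs
  have hsmR : (s : ℝ) ≤ m := by exact_mod_cast hsm
  have hlogs : Real.log s ≤ Real.log m := Real.log_le_log (by linarith) hsmR
  have hlogs0 : 0 ≤ Real.log s := Real.log_nonneg hsR
  have hlog : Real.log ((m : ℝ) / s) = Real.log m - Real.log s :=
    Real.log_div (by linarith) (by linarith)
  have hsplit := Finset.sum_Ioc_consecutive (fun q : ℕ => (Nat.totient q : ℝ) / q ^ 2)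
    (Nat.zero_le s) hsm
  rw [sum_totient_div_sq_eq_sum_moebius_mul_harmonic,
    sum_totient_div_sq_eq_sum_moebius_mul_harmonic,
    ← Finset.sum_Ioc_consecutive _ (Nat.zero_le s) hsm] at hsplit
  have hmain : |∑ d ∈ Finset.Ioc 0 s, (μ d : ℝ) / d ^ 2 *
      ((harmonic (m / d) : ℝ) - harmonic (s / d) - Real.log ((m : ℝ) / s))| ≤
      4 * (1 + Real.log m) / s := by
    calc _ ≤ ∑ d ∈ Finset.Ioc 0 s, 4 / (s : ℝ) * (d : ℝ)⁻¹ := by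
          refine (Finset.abs_sum_le_sum_abs _ _).trans (Finset.sum_le_sum fun d hd => ?_)
          rw [Finset.mem_Ioc] at hd
          have hdR : (0 : ℝ) < d := by exact_mod_cast hd.1
          have a1 := abs_harmonic_div_sub_log_sub_eulerMascheroni_le hd.1 hd.2
          have a2 := abs_harmonic_div_sub_log_sub_eulerMascheroni_le hd.1 (hd.2.trans hsm)
          have a3 : 2 * (d : ℝ) / m ≤ 2 * d / s := by gcongr
          rw [Real.log_div (by linarith) hdR.ne'] at a1 a2
          have a4 : |(harmonic (m / d) : ℝ) - harmonic (s / d) - Real.log ((m : ℝ) / s)| ≤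
              4 * d / s := by
            rw [hlog]
            have a5 : 4 * (d : ℝ) / s = 2 * d / s + 2 * d / s := by ring
            rw [a5]
            rw [abs_le] at *
            constructor <;> linarith
          rw [abs_mul]
          refine (mul_le_mul (abs_moebius_div_sq_le d) a4 (abs_nonneg _)
            (by positivity)).trans (le_of_eq ?_)
          field_simp
      _ = 4 / (s : ℝ) * (harmonic s : ℝ) := by
          rw [← Finset.mul_sum, harmonic_eq_sum_Icc]
          push_cast
          rfl
      _ ≤ 4 / (s : ℝ) * (1 + Real.log m) := by
          gcongr
          exact (harmonic_le_one_add_log s).trans (by linarith)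
      _ = _ := by ring
  have htail : |∑ d ∈ Finset.Ioc s m, (μ d : ℝ) / d ^ 2 * (harmonic (m / d) : ℝ)| ≤
      (1 + Real.log m) / s := by
    calc _ ≤ ∑ d ∈ Finset.Ioc s m, ((d : ℝ) ^ 2)⁻¹ * (1 + Real.log m) := by
          refine (Finset.abs_sum_le_sum_abs _ _).trans (Finset.sum_le_sum fun d hd => ?_)
          rw [Finset.mem_Ioc] at hd
          have hk : 0 < m / d := Nat.div_pos hd.2 (by omega)
          have hh : (0 : ℝ) ≤ harmonic (m / d) := by exact_mod_cast (harmonic_pos hk.ne').le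
          rw [abs_mul, abs_of_nonneg hh]
          refine mul_le_mul (abs_moebius_div_sq_le d) ?_ hh (by positivity)
          refine (harmonic_le_one_add_log _).trans ?_
          have : Real.log ((m / d : ℕ) : ℝ) ≤ Real.log m :=
            Real.log_le_log (by exact_mod_cast hk) (by exact_mod_cast Nat.div_le_self m d)
          linarith
      _ ≤ (s : ℝ)⁻¹ * (1 + Real.log m) := by
          rw [← Finset.sum_mul]
          have := sum_Ioc_inv_sq_le_sub (α := ℝ) hs.ne' hsm
          have h0 : (0 : ℝ) ≤ (m : ℝ)⁻¹ := by positivity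
          exact mul_le_mul_of_nonneg_right (by linarith) (by linarith)
      _ = _ := by ring
  have hmoeb : |(∑ d ∈ Finset.Ioc 0 s, (μ d : ℝ) / d ^ 2 - 6 / Real.pi ^ 2) *
      Real.log ((m : ℝ) / s)| ≤ Real.log m / s := by
    rw [abs_mul, abs_of_nonneg (by linarith : 0 ≤ Real.log ((m : ℝ) / s))]
    refine (mul_le_mul (abs_sum_moebius_div_sq_sub_le hs)
      (by linarith : Real.log ((m : ℝ) / s) ≤ Real.log m) (by linarith)
      (by positivity)).trans (le_of_eq (by ring))
  have hexp : ∑ q ∈ Finset.Ioc s m, (Nat.totient q : ℝ) / q ^ 2 -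
        6 / Real.pi ^ 2 * Real.log ((m : ℝ) / s) =
      ∑ d ∈ Finset.Ioc 0 s, (μ d : ℝ) / d ^ 2 *
        ((harmonic (m / d) : ℝ) - harmonic (s / d) - Real.log ((m : ℝ) / s)) +
      ∑ d ∈ Finset.Ioc s m, (μ d : ℝ) / d ^ 2 * (harmonic (m / d) : ℝ) +
      (∑ d ∈ Finset.Ioc 0 s, (μ d : ℝ) / d ^ 2 - 6 / Real.pi ^ 2) *
        Real.log ((m : ℝ) / s) := by
    simp only [mul_sub, Finset.sum_sub_distrib, ← Finset.sum_mul, sub_mul]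
    linarith
  rw [hexp]
  refine (abs_add_three _ _ _).trans ((add_le_add_three hmain htail hmoeb).trans (le_of_eq ?_))
  ring

/-- There is a constant `K > 0` such that for every integer `m ≥ 2`,
`|∑_{√m < q ≤ m} φ(q)/q² - (3/π²) ln m| ≤ K (ln m)/√m`; that is,
`∑_{√m < q ≤ m} φ(q)/q² = (1/(2 ζ(2))) ln m + O((ln m)/√m)`. -/
theorem sum_totient_div_sq_tail_asymptotic :
    ∃ K : ℝ, 0 < K ∧ ∀ m : ℕ, 2 ≤ m →
      |(∑ q ∈ Finset.Icc (Nat.sqrt m + 1) m, (Nat.totient q : ℝ) / q ^ 2) -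
          (3 / Real.pi ^ 2) * Real.log m| ≤
        K * Real.log m / Real.sqrt m := by
  refine ⟨36, by norm_num, fun m hm => ?_⟩
  have hs : 0 < Nat.sqrt m := Nat.sqrt_pos.2 (by omega)
  have h := abs_sum_Ioc_totient_div_sq_sub_le hs (Nat.sqrt_le_self m)
  have hIcc : Finset.Icc (Nat.sqrt m + 1) m = Finset.Ioc (Nat.sqrt m) m := by
    ext
    simp
  rw [hIcc]
  have hle : (Nat.sqrt m : ℝ) ≤ Real.sqrt m := Real.nat_sqrt_le_real_sqrt
  have hlt : Real.sqrt m ≤ Nat.sqrt m + 1 := Real.real_sqrt_le_nat_sqrt_succ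
  generalize Nat.sqrt m = s at *
  have hsR : (1 : ℝ) ≤ s := by exact_mod_cast hs
  have hmR : (2 : ℝ) ≤ m := by exact_mod_cast hm
  have hL : 1 / 2 ≤ Real.log m :=
    (by linarith [Real.log_two_gt_d9] : 1 / 2 ≤ Real.log 2).trans
      (Real.log_le_log (by norm_num) hmR)
  have hlog : Real.log ((m : ℝ) / s) = Real.log m - Real.log s :=
    Real.log_div (by linarith) (by linarith)
  have hsqrt : Real.log (Real.sqrt m) = Real.log m / 2 := Real.log_sqrt (by linarith)
  have d0 : Real.log s ≤ Real.log (Real.sqrt m) := Real.log_le_log (by linarith) hle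
  have d1 : Real.log (Real.sqrt m) - Real.log s ≤ 1 / s := by
    rw [← Real.log_div (by linarith) (by linarith)]
    refine (Real.log_le_sub_one_of_pos (div_pos (by linarith) (by linarith))).trans ?_
    rw [div_sub_one (by linarith)]
    gcongr
    linarith
  have hpi : 6 / Real.pi ^ 2 ≤ 1 := by
    rw [div_le_one (by positivity)]
    nlinarith [Real.pi_gt_three]
  have hcorr : |6 / Real.pi ^ 2 * (Real.log (Real.sqrt m) - Real.log s)| ≤ 1 / (s : ℝ) := by
    rw [abs_of_nonneg (mul_nonneg (by positivity) (by linarith))]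
    exact (mul_le_of_le_one_left (by linarith) hpi).trans d1
  have hexp : ∑ q ∈ Finset.Ioc s m, (Nat.totient q : ℝ) / q ^ 2 -
        3 / Real.pi ^ 2 * Real.log m =
      (∑ q ∈ Finset.Ioc s m, (Nat.totient q : ℝ) / q ^ 2 -
        6 / Real.pi ^ 2 * Real.log ((m : ℝ) / s)) +
      6 / Real.pi ^ 2 * (Real.log (Real.sqrt m) - Real.log s) := by
    rw [hlog, hsqrt]
    ring
  rw [hexp]
  refine (abs_add_le _ _).trans ((add_le_add h hcorr).trans ?_)
  rw [← add_div, div_le_div_iff₀ (by linarith) (by linarith)]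
  have e1 : 5 + 6 * Real.log m + 1 ≤ 18 * Real.log m := by linarith
  have e2 : Real.sqrt m ≤ 2 * s := by linarith
  calc (5 + 6 * Real.log m + 1) * Real.sqrt m ≤ 18 * Real.log m * (2 * s) := by gcongr
    _ = 36 * Real.log m * s := by ring
end
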